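/- arXiv:hep-th/0609102 — 5 statements merged into one kernel-verified Lean document; each statement's English description precedes it below -/
import Mathlib

section
/- Let l > 0 and θ ∈ ℝ. For every s ∈ ℂ with Re s > 1 and Re((s−1)²) > 0, one has ∫₀^∞ e^{−s(s−2)t} Θ(t) dt = (1/(2(s−1))) · Z′(s)/Z(s), where the derivative Z′ is taken in the complex sense on the half-plane Re s > 0. -/
open Real MeasureTheory

/-- The theta function `Θ(t)` of the BTZ black hole with parameters `l, θ`. -/
noncomputable def ThetaBTZ (l θ t : ℝ) : ℝ :=
  l / (4 * Real.sqrt (4 * Real.pi * t)) *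
    ∑' n : ℕ, Real.exp (-(t + ((n : ℝ) + 1)^2 * l^2 / (4 * t))) /
      (Real.sinh (l * ((n : ℝ) + 1) / 2)^2 + Real.sin (θ * ((n : ℝ) + 1) / 2)^2)

/-- The Patterson–Selberg zeta function of the BTZ black hole with parameters `l, θ`:
`Z(s) = ∏_{k₁,k₂ ≥ 0} (1 − e^{iθ(k₁−k₂)} e^{−(k₁+k₂+s)l})`. -/
noncomputable def ZPS (l θ : ℝ) (s : ℂ) : ℂ :=
  ∏' k : ℕ × ℕ,
    (1 - Complex.exp (Complex.I * θ * ((k.1 : ℂ) - (k.2 : ℂ))) *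
      Complex.exp (-(((k.1 : ℂ) + (k.2 : ℂ) + s)) * l))

lemma hasDerivAt_mul_sqrt_sub_div_sqrt (x a : ℝ) {t : ℝ} (ht : 0 < t) :
    HasDerivAt (fun t : ℝ => x * √t - a / (2 * √t))
      (x / (2 * √t) + a / (4 * (t * √t))) t := by
  have h := Real.hasDerivAt_sqrt ht.ne'
  have hs : 0 < √t := Real.sqrt_pos.2 ht
  have h1 := (h.const_mul x).sub ((hasDerivAt_const t a).div (h.const_mul 2) (by positivity))
  refine h1.congr_deriv ?_
  field_simp
  rw [Real.sq_sqrt ht.le]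
  ring

lemma mul_sqrt_sub_div_sqrt_sq (x a : ℝ) {t : ℝ} (ht : 0 < t) :
    (x * √t - a / (2 * √t)) ^ 2 = x ^ 2 * t + a ^ 2 / (4 * t) - a * x := by
  obtain ⟨u, hu, rfl⟩ : ∃ u : ℝ, 0 < u ∧ t = u ^ 2 :=
    ⟨√t, Real.sqrt_pos.2 ht, (Real.sq_sqrt ht.le).symm⟩
  rw [Real.sqrt_sq hu.le]
  field_simp
  ring

lemma injOn_mul_sqrt_sub_div_sqrt {x a : ℝ} (hx : 0 < x) (ha : 0 < a) :
    Set.InjOn (fun t : ℝ => x * √t - a / (2 * √t)) (Set.Ioi 0) := by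
  refine StrictMonoOn.injOn fun s hs t ht hst => ?_
  rw [Set.mem_Ioi] at hs ht
  have h1 : √s < √t := Real.sqrt_lt_sqrt hs.le hst
  have hs' : 0 < √s := Real.sqrt_pos.2 hs
  have h2 : a / (2 * √t) < a / (2 * √s) := by gcongr
  have h3 : x * √s < x * √t := by gcongr
  linarith

lemma image_mul_sqrt_sub_div_sqrt {x a : ℝ} (hx : 0 < x) (ha : 0 < a) :
    (fun t : ℝ => x * √t - a / (2 * √t)) '' Set.Ioi 0 = Set.univ := by
  refine Set.eq_univ_of_forall fun y => ?_
  have hlt : |y| < √(y ^ 2 + 2 * a * x) := by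
    rw [← Real.sqrt_sq_eq_abs]
    exact Real.sqrt_lt_sqrt (sq_nonneg y) (by nlinarith [mul_pos ha hx])
  have hr : 0 < y + √(y ^ 2 + 2 * a * x) := by linarith [neg_abs_le y]
  have hsq : √(y ^ 2 + 2 * a * x) ^ 2 = y ^ 2 + 2 * a * x := Real.sq_sqrt (by positivity)
  set r := √(y ^ 2 + 2 * a * x)
  refine ⟨((y + r) / (2 * x)) ^ 2, Set.mem_Ioi.2 (by positivity), ?_⟩
  simp only
  rw [Real.sqrt_sq (by positivity)]
  field_simp
  linear_combination hsq

lemma integrableOn_deriv_mul_exp_neg_sq {x a : ℝ} (hx : 0 < x) (ha : 0 < a) :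
    IntegrableOn (fun t : ℝ => (x / (2 * √t) + a / (4 * (t * √t))) *
      rexp (-(x * √t - a / (2 * √t)) ^ 2)) (Set.Ioi 0) := by
  have h := (integrableOn_image_iff_integrableOn_abs_deriv_smul measurableSet_Ioi
    (fun t ht => (hasDerivAt_mul_sqrt_sub_div_sqrt x a ht).hasDerivWithinAt)
    (injOn_mul_sqrt_sub_div_sqrt hx ha) (fun v : ℝ => rexp (-v ^ 2))).1 (by
      rw [image_mul_sqrt_sub_div_sqrt hx ha, integrableOn_univ]
      simpa using integrable_exp_neg_mul_sq (b := 1) one_pos)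
  refine h.congr_fun (fun t ht => ?_) measurableSet_Ioi
  have ht : 0 < t := ht
  simp only [smul_eq_mul]
  rw [abs_of_pos (by positivity)]

lemma integral_deriv_mul_exp_neg_sq {x a : ℝ} (hx : 0 < x) (ha : 0 < a) :
    ∫ t in Set.Ioi (0 : ℝ), (x / (2 * √t) + a / (4 * (t * √t))) *
      rexp (-(x * √t - a / (2 * √t)) ^ 2) = √π := by
  have h := integral_image_eq_integral_abs_deriv_smul measurableSet_Ioi
    (fun t ht => (hasDerivAt_mul_sqrt_sub_div_sqrt x a ht).hasDerivWithinAt)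
    (injOn_mul_sqrt_sub_div_sqrt hx ha) (fun v : ℝ => rexp (-v ^ 2))
  rw [image_mul_sqrt_sub_div_sqrt hx ha, setIntegral_univ] at h
  have hg := integral_gaussian 1
  simp only [neg_mul, one_mul, div_one] at hg
  rw [← hg, h]
  refine setIntegral_congr_fun measurableSet_Ioi fun t ht => ?_
  have ht : 0 < t := ht
  simp only [smul_eq_mul]
  rw [abs_of_pos (by positivity)]

lemma integrableOn_exp_div_sqrt {x a : ℝ} (hx : 0 < x) (ha : 0 < a) :
    IntegrableOn (fun t : ℝ => rexp (-(x * √t - a / (2 * √t)) ^ 2) / √t) (Set.Ioi 0) := by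
  refine ((integrableOn_deriv_mul_exp_neg_sq hx ha).const_mul (2 / x)).mono'
    (Measurable.aestronglyMeasurable (by fun_prop)) ?_
  refine (ae_restrict_mem measurableSet_Ioi).mono fun t ht => ?_
  have ht : 0 < t := ht
  rw [Real.norm_of_nonneg (by positivity)]
  have h : 0 ≤ 2 / x * (a / (4 * (t * √t)) * rexp (-(x * √t - a / (2 * √t)) ^ 2)) := by positivity
  have h2 : rexp (-(x * √t - a / (2 * √t)) ^ 2) / √t
      = 2 / x * (x / (2 * √t) * rexp (-(x * √t - a / (2 * √t)) ^ 2)) := by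
    field_simp
  rw [h2, add_mul, mul_add]
  linarith

lemma integral_exp_div_mul_sqrt {x a : ℝ} (hx : 0 < x) (ha : 0 < a) :
    ∫ t in Set.Ioi (0 : ℝ), rexp (-(x * √t - a / (2 * √t)) ^ 2) / √t =
    ∫ t in Set.Ioi (0 : ℝ),
      a / (2 * x) * (rexp (-(x * √t - a / (2 * √t)) ^ 2) / (t * √t)) := by
  have himage : (fun t : ℝ => (a / (2 * x)) ^ 2 / t) '' Set.Ioi 0 = Set.Ioi 0 := by
    ext y
    simp only [Set.mem_image, Set.mem_Ioi]
    refine ⟨?_, fun hy => ⟨(a / (2 * x)) ^ 2 / y, by positivity, by field_simp⟩⟩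
    rintro ⟨t, ht, rfl⟩
    positivity
  have hinj : Set.InjOn (fun t : ℝ => (a / (2 * x)) ^ 2 / t) (Set.Ioi 0) := by
    intro s hs t ht hst
    have hs : 0 < s := hs
    have ht : 0 < t := ht
    simp only at hst
    field_simp at hst
    exact hst.symm
  have h := integral_image_eq_integral_abs_deriv_smul measurableSet_Ioi
    (f := fun t : ℝ => (a / (2 * x)) ^ 2 / t) (f' := fun t => -((a / (2 * x)) ^ 2 / t ^ 2))
    (fun t ht => by
      have ht : 0 < t := ht
      have := (hasDerivAt_inv ht.ne').const_mul ((a / (2 * x)) ^ 2)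
      refine HasDerivAt.hasDerivWithinAt ?_
      refine this.congr_deriv ?_
      field_simp) hinj
    (fun t : ℝ => rexp (-(x * √t - a / (2 * √t)) ^ 2) / √t)
  rw [himage] at h
  rw [h]
  refine setIntegral_congr_fun measurableSet_Ioi fun t ht => ?_
  obtain ⟨u, hu, rfl⟩ : ∃ u : ℝ, 0 < u ∧ t = u ^ 2 :=
    ⟨√t, Real.sqrt_pos.2 ht, (Real.sq_sqrt (le_of_lt ht)).symm⟩
  have h1 : √((a / (2 * x)) ^ 2 / u ^ 2) = a / (2 * x) / u := by
    rw [← div_pow, Real.sqrt_sq (by positivity)]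
  simp only [smul_eq_mul, h1, Real.sqrt_sq hu.le, abs_neg]
  rw [abs_of_pos (by positivity)]
  have h2 : (x * (a / (2 * x) / u) - a / (2 * (a / (2 * x) / u))) ^ 2
      = (x * u - a / (2 * u)) ^ 2 := by
    field_simp
    ring
  rw [h2]
  field_simp

lemma integrableOn_exp_neg_add_div_sqrt {x a : ℝ} (hx : 0 < x) (ha : 0 < a) :
    IntegrableOn (fun t : ℝ => rexp (-(x ^ 2 * t)) * (rexp (-(a ^ 2 / (4 * t))) / √t))
      (Set.Ioi 0) := by
  refine IntegrableOn.congr_fun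
    ((integrableOn_exp_div_sqrt hx ha).const_mul (rexp (-(a * x)))) (fun t ht => ?_)
    measurableSet_Ioi
  rw [mul_sqrt_sub_div_sqrt_sq x a ht, ← mul_div_assoc, ← mul_div_assoc, ← Real.exp_add,
    ← Real.exp_add]
  ring_nf

lemma integral_exp_neg_add_div_sqrt {x a : ℝ} (hx : 0 < x) (ha : 0 < a) :
    ∫ t in Set.Ioi (0 : ℝ), rexp (-(x ^ 2 * t)) * (rexp (-(a ^ 2 / (4 * t))) / √t) =
      √π / x * rexp (-(a * x)) := by
  have h0 : ∫ t in Set.Ioi (0 : ℝ), rexp (-(x ^ 2 * t)) * (rexp (-(a ^ 2 / (4 * t))) / √t) =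
      rexp (-(a * x)) * ∫ t in Set.Ioi (0 : ℝ), rexp (-(x * √t - a / (2 * √t)) ^ 2) / √t := by
    rw [← integral_const_mul]
    refine setIntegral_congr_fun measurableSet_Ioi fun t ht => ?_
    rw [mul_sqrt_sub_div_sqrt_sq x a ht, ← mul_div_assoc, ← mul_div_assoc, ← Real.exp_add,
      ← Real.exp_add]
    ring_nf
  have hI := integrableOn_exp_div_sqrt hx ha
  have h1 := integral_deriv_mul_exp_neg_sq hx ha
  have h2 := integral_exp_div_mul_sqrt hx ha
  have h3 : ∫ t in Set.Ioi (0 : ℝ), a / (2 * x) *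
      (rexp (-(x * √t - a / (2 * √t)) ^ 2) / (t * √t)) =
      2 / x * √π - ∫ t in Set.Ioi (0 : ℝ), rexp (-(x * √t - a / (2 * √t)) ^ 2) / √t := by
    rw [← h1, ← integral_const_mul, ← integral_sub
      ((integrableOn_deriv_mul_exp_neg_sq hx ha).const_mul _) hI]
    refine setIntegral_congr_fun measurableSet_Ioi fun t ht => ?_
    have ht : 0 < t := ht
    field_simp
    ring
  have h4 : ∫ t in Set.Ioi (0 : ℝ), rexp (-(x * √t - a / (2 * √t)) ^ 2) / √t = √π / x := by
    rw [h3] at h2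
    linear_combination h2 / 2
  rw [h0, h4, mul_comm]

/-- The Laplace transform of `t ↦ exp (-a² / (4t)) / √t` at `z²`, by analytic continuation from
real `z`. -/
lemma integral_cexp_neg_sq_mul_exp_div_sqrt {a : ℝ} (ha : 0 < a) {z : ℂ} (hz : 0 < z.re)
    (hz2 : 0 < (z ^ 2).re) :
    ∫ t in Set.Ioi (0 : ℝ), Complex.exp (-z ^ 2 * t) * ((rexp (-(a ^ 2 / (4 * t))) / √t : ℝ) : ℂ) =
      √π / z * Complex.exp (-(a * z)) := by
  set g : ℝ → NNReal := fun t => (rexp (-(a ^ 2 / (4 * t))) / √t).toNNReal with hg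
  have hgm : Measurable g := by fun_prop
  have hgc : ∀ t, (g t : ℝ) = rexp (-(a ^ 2 / (4 * t))) / √t := fun t =>
    Real.coe_toNNReal _ (by positivity)
  set μ : Measure ℝ := (volume.restrict (Set.Ioi 0)).withDensity fun t => (g t : ENNReal)
  have hmgf : ∀ w : ℂ, ProbabilityTheory.complexMGF id μ w =
      ∫ t in Set.Ioi (0 : ℝ), Complex.exp (w * t) *
        ((rexp (-(a ^ 2 / (4 * t))) / √t : ℝ) : ℂ) := fun w => by
    rw [ProbabilityTheory.complexMGF, integral_withDensity_eq_integral_smul hgm]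
    refine integral_congr_ae (.of_forall fun t => ?_)
    simp only [id, NNReal.smul_def, hgc, Complex.real_smul]
    rw [mul_comm]
  have hsub : Set.Iio 0 ⊆ interior (ProbabilityTheory.integrableExpSet id μ) := by
    rw [isOpen_Iio.subset_interior_iff]
    intro v hv
    have hv : v < 0 := hv
    rw [ProbabilityTheory.integrableExpSet, Set.mem_ofPred_eq,
      integrable_withDensity_iff_integrable_smul hgm]
    refine (integrableOn_exp_neg_add_div_sqrt (x := √(-v)) (Real.sqrt_pos.2 (by linarith))
      ha).congr (.of_forall fun t => ?_)
    simp only [id, NNReal.smul_def, hgc, smul_eq_mul]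
    rw [Real.sq_sqrt (by linarith), mul_comm]
    simp
  have hF : AnalyticOnNhd ℂ (ProbabilityTheory.complexMGF id μ) {w | w.re < 0} :=
    ProbabilityTheory.analyticOnNhd_complexMGF.mono fun w hw => hsub hw
  have hslit : ∀ w : ℂ, w.re < 0 → -w ∈ Complex.slitPlane := fun w hw =>
    Or.inl (by simpa using hw)
  have hG : AnalyticOnNhd ℂ (fun w : ℂ => √π / (-w) ^ (2⁻¹ : ℂ) *
      Complex.exp (-(a * (-w) ^ (2⁻¹ : ℂ)))) {w | w.re < 0} := by
    refine DifferentiableOn.analyticOnNhd (fun w hw => ?_) (Complex.isOpen_re_lt 0)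
    have hw := hslit w hw
    have h0 : (-w) ^ (2⁻¹ : ℂ) ≠ 0 := by
      simp [Complex.cpow_eq_zero_iff, Complex.slitPlane_ne_zero hw |> neg_ne_zero.1]
    have h1 : DifferentiableAt ℂ (fun w : ℂ => (-w) ^ (2⁻¹ : ℂ)) w :=
      differentiableAt_id.neg.cpow_const hw
    exact (((differentiableAt_const _).div h1 h0).mul
      (h1.const_mul (a : ℂ)).neg.cexp).differentiableWithinAt
  have hreal : ∀ y : ℝ, y < 0 → ProbabilityTheory.complexMGF id μ y =
      √π / (-(y : ℂ)) ^ (2⁻¹ : ℂ) * Complex.exp (-(a * (-(y : ℂ)) ^ (2⁻¹ : ℂ))) := by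
    intro y hy
    have hx : 0 < √(-y) := Real.sqrt_pos.2 (by linarith)
    have hy2 : -(y : ℂ) = (√(-y) : ℂ) ^ 2 := by
      rw [← Complex.ofReal_pow, Real.sq_sqrt (by linarith), Complex.ofReal_neg]
    rw [hmgf, hy2, Complex.sq_cpow_two_inv (by simpa using hx)]
    have h := congrArg (Complex.ofReal) (integral_exp_neg_add_div_sqrt hx ha)
    rw [Real.sq_sqrt (by linarith), ← integral_complex_ofReal] at h
    simp only [neg_mul, neg_neg] at h
    push_cast at h ⊢
    exact h
  have hfreq : ∃ᶠ w in nhdsWithin (((-1 : ℝ) : ℂ)) {((-1 : ℝ) : ℂ)}ᶜ,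
      ProbabilityTheory.complexMGF id μ w =
        √π / (-w) ^ (2⁻¹ : ℂ) * Complex.exp (-(a * (-w) ^ (2⁻¹ : ℂ))) := by
    have ht : Filter.Tendsto (fun y : ℝ => (y : ℂ)) (nhdsWithin (-1) {-1}ᶜ)
        (nhdsWithin (((-1 : ℝ) : ℂ)) {((-1 : ℝ) : ℂ)}ᶜ) :=
      (Complex.continuous_ofReal.tendsto (-1)).inf (Filter.tendsto_principal_principal.2
        fun y hy h => hy (Complex.ofReal_injective h))
    refine ht.frequently (Filter.Eventually.frequently ?_)
    filter_upwards [mem_nhdsWithin_of_mem_nhds (Iio_mem_nhds (by norm_num : (-1 : ℝ) < 0))]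
      with y hy using hreal y hy
  have heq := hF.eqOn_of_preconnected_of_frequently_eq hG
    (convex_halfSpace_re_lt 0).isPreconnected (by simp) hfreq
  have h := heq (x := -z ^ 2) (by simpa using hz2)
  simp only [neg_neg] at h
  rwa [hmgf, Complex.sq_cpow_two_inv hz] at h

lemma norm_cexp_neg_mul_exp_div_sqrt (w : ℂ) (a t : ℝ) :
    ‖Complex.exp (-w * t) * ((rexp (-(a ^ 2 / (4 * t))) / √t : ℝ) : ℂ)‖ =
      rexp (-(w.re * t)) * (rexp (-(a ^ 2 / (4 * t))) / √t) := by
  rw [norm_mul, Complex.norm_exp, Complex.norm_real, Real.norm_of_nonneg (by positivity)]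
  simp

lemma integrableOn_cexp_neg_mul_exp_div_sqrt {a : ℝ} (ha : 0 < a) {w : ℂ} (hw : 0 < w.re) :
    IntegrableOn (fun t : ℝ =>
      Complex.exp (-w * t) * ((rexp (-(a ^ 2 / (4 * t))) / √t : ℝ) : ℂ)) (Set.Ioi 0) := by
  refine (integrableOn_exp_neg_add_div_sqrt (Real.sqrt_pos.2 hw) ha).mono'
    (Measurable.aestronglyMeasurable (by fun_prop)) (.of_forall fun t => ?_)
  rw [norm_cexp_neg_mul_exp_div_sqrt, Real.sq_sqrt hw.le]

lemma norm_zpsFactor (l θ : ℝ) (k : ℕ × ℕ) (s : ℂ) :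
    ‖Complex.exp (Complex.I * θ * ((k.1 : ℂ) - (k.2 : ℂ))) *
      Complex.exp (-(((k.1 : ℂ) + (k.2 : ℂ) + s)) * l)‖ =
      rexp (k.1 * -l) * rexp (k.2 * -l) * rexp (s.re * -l) := by
  rw [norm_mul, Complex.norm_exp, Complex.norm_exp, ← Real.exp_add, ← Real.exp_add,
    ← Real.exp_add]
  congr 1
  simp
  ring

lemma summable_exp_mul_exp {l : ℝ} (hl : 0 < l) :
    Summable fun k : ℕ × ℕ => rexp (k.1 * -l) * rexp (k.2 * -l) := by
  have h : Summable fun n : ℕ => rexp (n * -l) := Real.summable_exp_nat_mul_iff.2 (by linarith)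
  exact h.mul_of_nonneg h (fun _ => (Real.exp_pos _).le) (fun _ => (Real.exp_pos _).le)

lemma norm_zpsFactor_le {l θ : ℝ} (hl : 0 < l) (k : ℕ × ℕ) {s : ℂ} (hs : 0 < s.re) :
    ‖Complex.exp (Complex.I * θ * ((k.1 : ℂ) - (k.2 : ℂ))) *
      Complex.exp (-(((k.1 : ℂ) + (k.2 : ℂ) + s)) * l)‖ ≤
      rexp (k.1 * -l) * rexp (k.2 * -l) := by
  rw [norm_zpsFactor]
  exact mul_le_of_le_one_right (by positivity) (Real.exp_le_one_iff.2 (by nlinarith))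

lemma norm_zpsFactor_lt_one {l θ : ℝ} (hl : 0 < l) (k : ℕ × ℕ) {s : ℂ} (hs : 0 < s.re) :
    ‖Complex.exp (Complex.I * θ * ((k.1 : ℂ) - (k.2 : ℂ))) *
      Complex.exp (-(((k.1 : ℂ) + (k.2 : ℂ) + s)) * l)‖ < 1 := by
  rw [norm_zpsFactor, ← Real.exp_add, ← Real.exp_add, Real.exp_lt_one_iff]
  have h1 : 0 ≤ (k.1 : ℝ) * l := by positivity
  have h2 : 0 ≤ (k.2 : ℝ) * l := by positivity
  nlinarith [mul_pos hs hl]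

lemma logDeriv_one_sub_zpsFactor (l θ : ℝ) (k : ℕ × ℕ) (s : ℂ) :
    logDeriv (fun s : ℂ => 1 - Complex.exp (Complex.I * θ * ((k.1 : ℂ) - (k.2 : ℂ))) *
      Complex.exp (-(((k.1 : ℂ) + (k.2 : ℂ) + s)) * l)) s =
      l * ((Complex.exp (Complex.I * θ * ((k.1 : ℂ) - (k.2 : ℂ))) *
        Complex.exp (-(((k.1 : ℂ) + (k.2 : ℂ) + s)) * l)) *
      (1 - Complex.exp (Complex.I * θ * ((k.1 : ℂ) - (k.2 : ℂ))) *
        Complex.exp (-(((k.1 : ℂ) + (k.2 : ℂ) + s)) * l))⁻¹) := by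
  have h : HasDerivAt (fun s : ℂ => 1 - Complex.exp (Complex.I * θ * ((k.1 : ℂ) - (k.2 : ℂ))) *
      Complex.exp (-(((k.1 : ℂ) + (k.2 : ℂ) + s)) * l))
      (-(Complex.exp (Complex.I * θ * ((k.1 : ℂ) - (k.2 : ℂ))) *
        (Complex.exp (-(((k.1 : ℂ) + (k.2 : ℂ) + s)) * l) * (-1 * l)))) s :=
    (((((hasDerivAt_id s).const_add ((k.1 : ℂ) + (k.2 : ℂ))).neg.mul_const (l : ℂ)).cexp.const_mul
      _).const_sub 1)
  rw [logDeriv_apply, h.deriv]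
  ring

lemma summable_zpsFactor_pow {l θ : ℝ} (hl : 0 < l) {s : ℂ} (hs : 0 < s.re) :
    Summable fun p : (ℕ × ℕ) × ℕ =>
      (Complex.exp (Complex.I * θ * ((p.1.1 : ℂ) - (p.1.2 : ℂ))) *
        Complex.exp (-(((p.1.1 : ℂ) + (p.1.2 : ℂ) + s)) * l)) ^ (p.2 + 1) := by
  have h3 : Summable fun n : ℕ => rexp (n * (s.re * -l)) :=
    Real.summable_exp_nat_mul_iff.2 (by nlinarith)
  refine Summable.of_norm_bounded ((summable_exp_mul_exp hl).mul_of_nonneg h3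
    (fun _ => by positivity) (fun _ => by positivity)) fun p => ?_
  rw [norm_pow, norm_zpsFactor, mul_pow, pow_succ (rexp (s.re * -l)), ← Real.exp_nat_mul]
  have h1 : (rexp (p.1.1 * -l) * rexp (p.1.2 * -l)) ^ (p.2 + 1) ≤
      rexp (p.1.1 * -l) * rexp (p.1.2 * -l) := by
    refine pow_le_of_le_one (by positivity) ?_ (by omega)
    refine mul_le_one₀ ?_ (by positivity) ?_ <;> rw [Real.exp_le_one_iff] <;>
    nlinarith [mul_nonneg (Nat.cast_nonneg (α := ℝ) p.1.1) hl.le,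
      mul_nonneg (Nat.cast_nonneg (α := ℝ) p.1.2) hl.le]
  have h2 : rexp (s.re * -l) ≤ 1 := Real.exp_le_one_iff.2 (by nlinarith)
  exact mul_le_mul h1 (mul_le_of_le_one_right (by positivity) h2) (by positivity) (by positivity)

lemma one_sub_cexp_mul_one_sub_cexp (l θ m : ℝ) :
    (1 - Complex.exp ((Complex.I * θ - l) * m)) * (1 - Complex.exp ((-Complex.I * θ - l) * m)) =
      4 * Complex.exp (-(l * m)) *
        ((Real.sinh (l * m / 2) ^ 2 + Real.sin (θ * m / 2) ^ 2 : ℝ) : ℂ) := by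
  have hsinh := Complex.two_sinh (l * m / 2)
  have hsin := Complex.two_sin (θ * m / 2)
  have h1 : Complex.exp ((Complex.I * θ - l) * m) =
      Complex.exp (θ * m / 2 * Complex.I) ^ 2 * Complex.exp (-(l * m / 2)) ^ 2 := by
    rw [← Complex.exp_nat_mul, ← Complex.exp_nat_mul, ← Complex.exp_add]
    push_cast
    ring_nf
  have h2 : Complex.exp ((-Complex.I * θ - l) * m) =
      Complex.exp (-(θ * m / 2) * Complex.I) ^ 2 * Complex.exp (-(l * m / 2)) ^ 2 := by
    rw [← Complex.exp_nat_mul, ← Complex.exp_nat_mul, ← Complex.exp_add]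
    push_cast
    ring_nf
  have h3 : Complex.exp (-(l * m)) = Complex.exp (-(l * m / 2)) ^ 2 := by
    rw [← Complex.exp_nat_mul]
    push_cast
    ring_nf
  have h4 : Complex.exp (l * m / 2) * Complex.exp (-(l * m / 2)) = 1 := by
    rw [← Complex.exp_add]; simp
  have h5 : Complex.exp (θ * m / 2 * Complex.I) * Complex.exp (-(θ * m / 2) * Complex.I) = 1 := by
    rw [← Complex.exp_add]; simp
  push_cast
  rw [h1, h2, h3]
  set p := Complex.exp (l * m / 2)
  set q := Complex.exp (-(l * m / 2))
  set r := Complex.exp (θ * m / 2 * Complex.I)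
  set u := Complex.exp (-(θ * m / 2) * Complex.I)
  have h6 : 4 * Complex.sinh (l * m / 2) ^ 2 = (p - q) ^ 2 := by rw [← hsinh]; ring
  have h7 : 4 * Complex.sin (θ * m / 2) ^ 2 = -(u - r) ^ 2 := by
    have : 4 * Complex.sin (θ * m / 2) ^ 2 = ((u - r) * Complex.I) ^ 2 := by rw [← hsin]; ring
    rw [this, mul_pow, Complex.I_sq]; ring
  linear_combination -q ^ 2 * h6 - q ^ 2 * h7 + (q ^ 4 * (r * u + 1) - 2 * q ^ 2) * h5 +
    (-p * q - 1 + 2 * q ^ 2) * h4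

lemma tsum_zpsFactor_pow {l : ℝ} (θ : ℝ) (hl : 0 < l) (s : ℂ) (n : ℕ) :
    ∑' k : ℕ × ℕ, (Complex.exp (Complex.I * θ * ((k.1 : ℂ) - (k.2 : ℂ))) *
        Complex.exp (-(((k.1 : ℂ) + (k.2 : ℂ) + s)) * l)) ^ (n + 1) =
      Complex.exp (-(((l * (n + 1) : ℝ) : ℂ) * (s - 1))) /
        (4 * ((Real.sinh (l * (n + 1) / 2) ^ 2 + Real.sin (θ * (n + 1) / 2) ^ 2 : ℝ) : ℂ)) := by
  set α := Complex.exp ((Complex.I * θ - l) * (n + 1 : ℝ)) with hα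
  set β := Complex.exp ((-Complex.I * θ - l) * (n + 1 : ℝ)) with hβ
  have hlt : -(l * ((n : ℝ) + 1)) < 0 := by
    have : 0 < l * ((n : ℝ) + 1) := by positivity
    linarith
  have hα1 : ‖α‖ < 1 := by
    rw [hα, Complex.norm_exp, Real.exp_lt_one_iff, Complex.re_mul_ofReal]
    simpa using hlt
  have hβ1 : ‖β‖ < 1 := by
    rw [hβ, Complex.norm_exp, Real.exp_lt_one_iff, Complex.re_mul_ofReal]
    simpa using hlt
  have hterm : ∀ k : ℕ × ℕ, (Complex.exp (Complex.I * θ * ((k.1 : ℂ) - (k.2 : ℂ))) *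
        Complex.exp (-(((k.1 : ℂ) + (k.2 : ℂ) + s)) * l)) ^ (n + 1) =
      Complex.exp (-(l * (n + 1) * s)) * (α ^ k.1 * β ^ k.2) := by
    intro k
    rw [hα, hβ, ← Complex.exp_add, ← Complex.exp_nat_mul, ← Complex.exp_nat_mul,
      ← Complex.exp_nat_mul, ← Complex.exp_add, ← Complex.exp_add]
    push_cast
    ring_nf
  rw [tsum_congr hterm, tsum_mul_left, ← tsum_mul_tsum_of_summable_norm
    (summable_norm_geometric_of_norm_lt_one hα1) (summable_norm_geometric_of_norm_lt_one hβ1),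
    tsum_geometric_of_norm_lt_one hα1, tsum_geometric_of_norm_lt_one hβ1, ← mul_inv,
    one_sub_cexp_mul_one_sub_cexp]
  have he : Complex.exp (-(((l * (n + 1) : ℝ) : ℂ) * (s - 1))) =
      Complex.exp (-(l * (n + 1) * s)) * (Complex.exp (-(l * ((n + 1 : ℝ) : ℂ))))⁻¹ := by
    rw [← Complex.exp_neg, ← Complex.exp_add]
    push_cast
    ring_nf
  rw [he, div_eq_mul_inv (_ * _) (4 * _)]
  simp only [mul_inv]
  ring

/-- The logarithmic derivative of the Patterson–Selberg zeta function as a Dirichlet-type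
series. -/
lemma deriv_ZPS_div_ZPS {l θ : ℝ} (hl : 0 < l) {s : ℂ} (hs : 0 < s.re) :
    deriv (ZPS l θ) s / ZPS l θ s =
      ∑' n : ℕ, l * (Complex.exp (-(((l * (n + 1) : ℝ) : ℂ) * (s - 1))) /
        (4 * ((Real.sinh (l * (n + 1) / 2) ^ 2 + Real.sin (θ * (n + 1) / 2) ^ 2 : ℝ) : ℂ))) := by
  set q : ℕ × ℕ → ℂ → ℂ := fun k s => Complex.exp (Complex.I * θ * ((k.1 : ℂ) - (k.2 : ℂ))) *
      Complex.exp (-(((k.1 : ℂ) + (k.2 : ℂ) + s)) * l) with hq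
  have hqs : ∀ k, ‖q k s‖ < 1 := fun k => norm_zpsFactor_lt_one hl k hs
  have hpow : Summable fun p : (ℕ × ℕ) × ℕ => q p.1 s ^ (p.2 + 1) := summable_zpsFactor_pow hl hs
  have hgeom : ∀ k, ∑' n : ℕ, q k s ^ (n + 1) = q k s * (1 - q k s)⁻¹ := fun k => by
    simp_rw [pow_succ']
    rw [tsum_mul_left, tsum_geometric_of_norm_lt_one (hqs k)]
  have hlog : ∀ k, logDeriv (fun s => 1 - q k s) s = l * ∑' n : ℕ, q k s ^ (n + 1) := fun k => by
    rw [hgeom]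
    exact logDeriv_one_sub_zpsFactor l θ k s
  have hne : ∀ k, 1 - q k s ≠ 0 := fun k h => by
    have := hqs k
    rw [← sub_eq_zero.1 h] at this
    simp at this
  have hd : ∀ k, Differentiable ℂ (q k) := fun k => by
    simp only [hq]
    fun_prop
  have hmul : MultipliableLocallyUniformlyOn (fun k s => 1 - q k s) {s : ℂ | 0 < s.re} := by
    simp_rw [sub_eq_add_neg]
    refine Summable.multipliableLocallyUniformlyOn_one_add (f := fun k s => -q k s)
      (Complex.isOpen_re_gt 0) (summable_exp_mul_exp hl) (.of_forall fun k w hw => ?_)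
      fun k => (hd k).continuous.neg.continuousOn
    rw [norm_neg]
    exact norm_zpsFactor_le hl k hw
  have hprod : ∏' k, (1 - q k s) ≠ 0 := by
    simp_rw [sub_eq_add_neg]
    refine tprod_one_add_ne_zero_of_summable (fun k => by
      rw [← sub_eq_add_neg]; exact hne k) ?_
    simp_rw [norm_neg]
    exact (summable_exp_mul_exp hl).of_nonneg_of_le (fun _ => norm_nonneg _)
      fun k => norm_zpsFactor_le hl k hs
  have key := logDeriv_tprod_eq_tsum (f := fun k s => 1 - q k s) (Complex.isOpen_re_gt 0)
    (x := s) hs hne (fun k => ((hd k).const_sub 1).differentiableOn)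
    (by simp_rw [hlog]; exact hpow.prod.mul_left _) hmul hprod
  have hZ : ZPS l θ = fun s => ∏' k, (1 - q k s) := rfl
  rw [← logDeriv_apply, hZ, key, tsum_congr hlog, tsum_mul_left, tsum_mul_left]
  congr 1
  rw [← (show Summable (Function.uncurry fun k n => q k s ^ (n + 1)) from hpow).tsum_comm]
  exact tsum_congr fun n => tsum_zpsFactor_pow θ hl s n

lemma summable_exp_neg_div_sinh_sq_add_sin_sq {l : ℝ} (θ : ℝ) (hl : 0 < l) {x : ℝ} (hx : 0 < x) :
    Summable fun n : ℕ => rexp (-(l * (n + 1) * x)) /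
      (Real.sinh (l * (n + 1) / 2) ^ 2 + Real.sin (θ * (n + 1) / 2) ^ 2) := by
  have h : Summable fun n : ℕ => rexp (n * -(l * x)) / Real.sinh (l / 2) ^ 2 :=
    (Real.summable_exp_nat_mul_iff.2 (by nlinarith [mul_pos hl hx])).div_const _
  refine h.of_nonneg_of_le (fun n => by positivity) fun n => ?_
  have hpos : 0 < Real.sinh (l / 2) := Real.sinh_pos_iff.2 (by positivity)
  have hle : Real.sinh (l / 2) ≤ Real.sinh (l * (n + 1) / 2) := by
    rw [Real.sinh_le_sinh]
    nlinarith [mul_nonneg hl.le (Nat.cast_nonneg (α := ℝ) n)]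
  have h1 : Real.sinh (l / 2) ^ 2 ≤ Real.sinh (l * (n + 1) / 2) ^ 2 := by gcongr
  have h2 : rexp (-(l * (n + 1) * x)) ≤ rexp (n * -(l * x)) :=
    Real.exp_le_exp.2 (by nlinarith [mul_pos hl hx])
  have h3 := sq_nonneg (Real.sin (θ * (n + 1) / 2))
  exact div_le_div₀ (Real.exp_pos _).le h2 (by positivity) (by linarith)

lemma cexp_mul_ThetaBTZ (l θ : ℝ) (s : ℂ) (t : ℝ) :
    Complex.exp (-s * (s - 2) * t) * (ThetaBTZ l θ t : ℂ) =
      ∑' n : ℕ, ((l / (8 * √π) /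
        (Real.sinh (l * (n + 1) / 2) ^ 2 + Real.sin (θ * (n + 1) / 2) ^ 2) : ℝ) : ℂ) *
        (Complex.exp (-(s - 1) ^ 2 * t) *
          ((rexp (-((l * (n + 1)) ^ 2 / (4 * t))) / √t : ℝ) : ℂ)) := by
  rw [ThetaBTZ, ← tsum_mul_left, Complex.ofReal_tsum, ← tsum_mul_left]
  refine tsum_congr fun n => ?_
  have hsqrt : √(4 * π * t) = 2 * √π * √t := by
    rw [Real.sqrt_mul (by positivity), Real.sqrt_mul (by norm_num),
      show (4 : ℝ) = 2 ^ 2 by norm_num, Real.sqrt_sq (by norm_num)]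
  have he : Complex.exp (-s * (s - 2) * t) =
      Complex.exp (-(s - 1) ^ 2 * t) * ((rexp t : ℝ) : ℂ) := by
    rw [Complex.ofReal_exp, ← Complex.exp_add]
    ring_nf
  have he2 : rexp (-(t + ((n : ℝ) + 1) ^ 2 * l ^ 2 / (4 * t))) =
      (rexp t)⁻¹ * rexp (-((l * (n + 1)) ^ 2 / (4 * t))) := by
    rw [← Real.exp_neg, ← Real.exp_add]
    ring_nf
  have het : ((rexp t : ℝ) : ℂ) ≠ 0 := by exact_mod_cast (Real.exp_pos t).ne'
  rw [he, he2, hsqrt]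
  simp only [Complex.ofReal_mul, Complex.ofReal_div, Complex.ofReal_inv]
  field_simp
  norm_num
  ring

/-- `∫₀^∞ e^{−s(s−2)t} Θ(t) dt = Z′(s)/(2(s−1)Z(s))` for `Re s > 1`, `Re (s−1)² > 0`. -/
theorem btz_theta_laplace_eq_log_deriv_zeta (l θ : ℝ) (hl : 0 < l)
    (s : ℂ) (hs : 1 < s.re) (hs2 : 0 < ((s - 1)^2).re) :
    ∫ t in Set.Ioi (0 : ℝ), Complex.exp (-s * (s - 2) * t) * (ThetaBTZ l θ t : ℂ)
      = 1 / (2 * (s - 1)) * (deriv (ZPS l θ) s / ZPS l θ s) := by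
  have hz : 0 < (s - 1).re := by simpa using hs
  have ha : ∀ n : ℕ, 0 < l * ((n : ℝ) + 1) := fun n => by positivity
  simp_rw [cexp_mul_ThetaBTZ l θ s]
  rw [← integral_tsum_of_summable_integral_norm
      (fun n => (integrableOn_cexp_neg_mul_exp_div_sqrt (ha n) hs2).const_mul _),
    deriv_ZPS_div_ZPS hl (by linarith), ← tsum_mul_left]
  · refine tsum_congr fun n => ?_
    rw [integral_const_mul, integral_cexp_neg_sq_mul_exp_div_sqrt (ha n) hz hs2]
    have hπ : ((√π : ℝ) : ℂ) ≠ 0 := by exact_mod_cast (Real.sqrt_pos.2 Real.pi_pos).ne'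
    have hs1 : s - 1 ≠ 0 := fun h => by simp [h] at hz
    simp only [Complex.ofReal_mul, Complex.ofReal_div]
    field_simp
    norm_num
    ring
  · have hx := Real.sqrt_pos.2 hs2
    refine ((summable_exp_neg_div_sinh_sq_add_sin_sq θ hl hx).mul_left
      (l / (8 * √π) * (√π / √((s - 1) ^ 2).re))).congr fun n => ?_
    simp_rw [norm_mul _ (_ * _), norm_cexp_neg_mul_exp_div_sqrt]
    rw [integral_const_mul, Complex.norm_real, Real.norm_of_nonneg (by positivity)]
    have h := integral_exp_neg_add_div_sqrt hx (ha n)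
    rw [Real.sq_sqrt hs2.le] at h
    rw [h]
    ring
end

section
/- Let l > 0 and θ ∈ ℝ. For every s ∈ ℂ with Re s > 1 and Re((s−1)²) > 0, one has ∫₀^∞ e^{−s(s−2)t} Θ(t) dt = (l/(8(s−1))) · Σ_{n=1}^∞ e^{−nl(s−1)} / (sinh²(ln/2) + sin²(θn/2)). -/
open Real MeasureTheory

open FourierTransform in
theorem fourier_cexp_neg_mul_abs {w : ℂ} (hw : 0 < w.re) (ξ : ℝ) :
    𝓕 (fun x : ℝ => Complex.exp (-w * (|x| : ℝ))) ξ =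
      2 * w / (w ^ 2 + ((4 * π ^ 2 * ξ ^ 2 : ℝ) : ℂ)) := by
  set p : ℂ := w - 2 * π * ξ * Complex.I with hp
  set q : ℂ := w + 2 * π * ξ * Complex.I with hq
  have hpre : p.re = w.re := by simp [hp]
  have hqre : q.re = w.re := by simp [hq]
  have hp0 : p ≠ 0 := fun h => by simp [h] at hpre; linarith
  have hq0 : q ≠ 0 := fun h => by simp [h] at hqre; linarith
  have hleft : ∀ x ∈ Set.Iic (0 : ℝ), Complex.exp (↑(-2 * π * x * ξ) * Complex.I) •
      Complex.exp (-w * (|x| : ℝ)) = Complex.exp (p * x) := by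
    intro x hx
    rw [abs_of_nonpos hx, smul_eq_mul, ← Complex.exp_add]
    congr 1
    push_cast
    ring
  have hright : ∀ x ∈ Set.Ioi (0 : ℝ), Complex.exp (↑(-2 * π * x * ξ) * Complex.I) •
      Complex.exp (-w * (|x| : ℝ)) = Complex.exp (-q * x) := by
    intro x hx
    rw [abs_of_pos hx, smul_eq_mul, ← Complex.exp_add]
    congr 1
    push_cast
    ring
  have hpos : 0 < p.re := hpre ▸ hw
  have hneg : (-q).re < 0 := by rw [Complex.neg_re, hqre]; linarith
  rw [Real.fourier_real_eq_integral_exp_smul, ← intervalIntegral.integral_Iic_add_Ioi (b := 0)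
    ((integrableOn_exp_mul_complex_Iic hpos 0).congr_fun
      (fun x hx => (hleft x hx).symm) measurableSet_Iic)
    ((integrableOn_exp_mul_complex_Ioi hneg 0).congr_fun
      (fun x hx => (hright x hx).symm) measurableSet_Ioi),
    setIntegral_congr_fun measurableSet_Iic hleft, setIntegral_congr_fun measurableSet_Ioi hright,
    integral_exp_mul_complex_Iic hpos, integral_exp_mul_complex_Ioi hneg]
  have hpq : w ^ 2 + ((4 * π ^ 2 * ξ ^ 2 : ℝ) : ℂ) = p * q := by
    simp only [hp, hq]
    push_cast
    linear_combination (4 * (π : ℂ) ^ 2 * ξ ^ 2) * Complex.I_sq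
  have hsum : 2 * w = p + q := by simp only [hp, hq]; ring
  rw [hpq, hsum]
  simp only [Complex.ofReal_zero, mul_zero, Complex.exp_zero]
  field_simp
  ring

theorem integrable_cexp_neg_mul_abs {w : ℂ} (hw : 0 < w.re) :
    Integrable (fun x : ℝ => Complex.exp (-w * (|x| : ℝ))) := by
  rw [← integrableOn_univ, ← Set.Iic_union_Ioi (a := (0 : ℝ))]
  refine IntegrableOn.union ?_ ?_
  · refine (integrableOn_exp_mul_complex_Iic hw 0).congr_fun (fun x hx => ?_) measurableSet_Iic
    simp [abs_of_nonpos (Set.mem_Iic.1 hx)]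
  · refine (integrableOn_exp_mul_complex_Ioi (a := -w) (by simpa using hw) 0).congr_fun
      (fun x hx => ?_) measurableSet_Ioi
    simp [abs_of_pos (Set.mem_Ioi.1 hx)]

theorem integrable_inv_add_four_pi_sq_mul_sq {c : ℝ} (hc : 0 < c) :
    Integrable (fun ξ : ℝ => (c + 4 * π ^ 2 * ξ ^ 2)⁻¹) := by
  refine (integrable_inv_one_add_sq.const_mul (min c 1)⁻¹).mono' ?_ (.of_forall fun ξ => ?_)
  · exact Measurable.aestronglyMeasurable (by fun_prop)
  · have hm : 0 < min c 1 := lt_min hc one_pos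
    have h1 : min c 1 ≤ c := min_le_left _ _
    have h2 : min c 1 ≤ 1 := min_le_right _ _
    have hpi : 1 ≤ π ^ 2 := by nlinarith [Real.pi_gt_three]
    rw [Real.norm_of_nonneg (by positivity), ← mul_inv]
    refine inv_anti₀ (by positivity) ?_
    nlinarith [mul_le_mul_of_nonneg_right (h2.trans hpi) (sq_nonneg ξ),
      mul_nonneg (sq_nonneg π) (sq_nonneg ξ)]

theorem re_add_le_norm_add_ofReal (z : ℂ) (x : ℝ) : z.re + x ≤ ‖z + (x : ℂ)‖ := by
  simpa using Complex.re_le_norm (z + (x : ℂ))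

open FourierTransform in
/-- Fourier inversion for the Cauchy-type kernel `1 / (w² + 4π²ξ²)`. -/
theorem integral_cexp_mul_inv_sq_add_four_pi_sq_mul_sq {w : ℂ} (hw : 0 < w.re)
    (hw2 : 0 < (w ^ 2).re) {a : ℝ} (ha : 0 ≤ a) :
    ∫ ξ : ℝ, Complex.exp (↑(2 * π * ξ * a) * Complex.I) *
      (w ^ 2 + ((4 * π ^ 2 * ξ ^ 2 : ℝ) : ℂ))⁻¹ = Complex.exp (-w * a) / (2 * w) := by
  have hw0 : w ≠ 0 := fun h => by simp [h] at hw
  have hF := funext (fourier_cexp_neg_mul_abs hw)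
  have hint : Integrable (𝓕 (fun x : ℝ => Complex.exp (-w * (|x| : ℝ)))) := by
    rw [hF]
    simp_rw [div_eq_mul_inv]
    refine Integrable.const_mul ?_ _
    refine (integrable_inv_add_four_pi_sq_mul_sq hw2).mono' ?_ (.of_forall fun ξ => ?_)
    · exact Measurable.aestronglyMeasurable (by fun_prop)
    · rw [norm_inv]
      exact inv_anti₀ (by positivity) (re_add_le_norm_add_ofReal _ _)
  have hcont : Continuous (fun x : ℝ => Complex.exp (-w * (|x| : ℝ))) := by fun_prop
  have hinv := congrFun (hcont.fourierInv_fourier_eq (integrable_cexp_neg_mul_abs hw) hint) a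
  rw [hF, Real.fourierInv_eq'] at hinv
  rw [abs_of_nonneg ha] at hinv
  rw [← hinv, eq_div_iff (by simpa using hw0), ← integral_mul_const]
  refine integral_congr_ae (.of_forall fun ξ => ?_)
  simp only [smul_eq_mul, RCLike.inner_apply, conj_trivial, div_eq_mul_inv]
  rw [mul_comm a ξ, ← mul_assoc (2 * π) ξ a]
  ring

theorem integral_cexp_mul_cexp_neg_heat {t : ℝ} (ht : 0 < t) (a : ℝ) :
    ∫ ξ : ℝ, Complex.exp (↑(2 * π * ξ * a) * Complex.I) *
      Complex.exp (-((4 * π ^ 2 * ξ ^ 2 : ℝ) : ℂ) * t) =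
      ((Real.exp (-(a ^ 2 / (4 * t))) / √(4 * π * t) : ℝ) : ℂ) := by
  have hb : 0 < ((4 * π ^ 2 * t : ℝ) : ℂ).re := by
    rw [Complex.ofReal_re]; positivity
  have h := fourierIntegral_gaussian hb ((2 * π * a : ℝ) : ℂ)
  have hroot : ((π : ℂ) / ((4 * π ^ 2 * t : ℝ) : ℂ)) ^ (1 / 2 : ℂ) =
      (((√(4 * π * t))⁻¹ : ℝ) : ℂ) := by
    rw [← Complex.ofReal_div, show (1 / 2 : ℂ) = ((1 / 2 : ℝ) : ℂ) by norm_num,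
      ← Complex.ofReal_cpow (by positivity), ← Real.sqrt_eq_rpow, ← Real.sqrt_inv]
    congr 2
    field_simp
  have hexp : -((2 * π * a : ℝ) : ℂ) ^ 2 / (4 * ((4 * π ^ 2 * t : ℝ) : ℂ)) =
      ((-(a ^ 2 / (4 * t)) : ℝ) : ℂ) := by
    norm_cast
    field_simp
    ring
  rw [hroot, hexp] at h
  rw [div_eq_inv_mul, Complex.ofReal_mul, Complex.ofReal_exp, ← h]
  refine integral_congr_ae (.of_forall fun ξ => ?_)
  simp only
  congr 2
  · push_cast; ring
  · push_cast; ring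

theorem integrable_laplace_heat_fourier {w : ℂ} (hw2 : 0 < (w ^ 2).re) (a : ℝ) :
    Integrable (Function.uncurry fun t ξ : ℝ => Complex.exp (-w ^ 2 * t) *
      (Complex.exp (↑(2 * π * ξ * a) * Complex.I) *
        Complex.exp (-((4 * π ^ 2 * ξ ^ 2 : ℝ) : ℂ) * t)))
      ((volume.restrict (Set.Ioi (0 : ℝ))).prod volume) := by
  have hnorm (t ξ : ℝ) : ‖Complex.exp (-w ^ 2 * t) *
      (Complex.exp (↑(2 * π * ξ * a) * Complex.I) *
        Complex.exp (-((4 * π ^ 2 * ξ ^ 2 : ℝ) : ℂ) * t))‖ =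
      Real.exp (-((w ^ 2).re + 4 * π ^ 2 * ξ ^ 2) * t) := by
    rw [norm_mul, norm_mul, Complex.norm_exp_ofReal_mul_I, one_mul, Complex.norm_exp,
      Complex.norm_exp, ← Real.exp_add]
    congr 1
    rw [Complex.re_mul_ofReal, Complex.re_mul_ofReal, Complex.neg_re, Complex.neg_re,
      Complex.ofReal_re]
    ring
  have hneg (ξ : ℝ) : -((w ^ 2).re + 4 * π ^ 2 * ξ ^ 2) < 0 := by
    have : 0 ≤ 4 * π ^ 2 * ξ ^ 2 := by positivity
    linarith
  have hmeas : AEStronglyMeasurable (Function.uncurry fun t ξ : ℝ => Complex.exp (-w ^ 2 * t) *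
      (Complex.exp (↑(2 * π * ξ * a) * Complex.I) *
        Complex.exp (-((4 * π ^ 2 * ξ ^ 2 : ℝ) : ℂ) * t)))
      ((volume.restrict (Set.Ioi (0 : ℝ))).prod volume) := by
    refine Continuous.aestronglyMeasurable ?_
    unfold Function.uncurry
    fun_prop
  rw [integrable_prod_iff' hmeas]
  refine ⟨.of_forall fun ξ => ?_, ?_⟩
  · refine (integrable_norm_iff (Continuous.aestronglyMeasurable ?_)).1 ?_
    · unfold Function.uncurry
      fun_prop
    · simp only [Function.uncurry_apply_pair, hnorm]
      exact integrableOn_exp_mul_Ioi (hneg ξ) 0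
  · simp only [Function.uncurry_apply_pair, hnorm]
    refine (integrable_inv_add_four_pi_sq_mul_sq hw2).congr (.of_forall fun ξ => ?_)
    simp only
    rw [integral_exp_mul_Ioi (hneg ξ) 0]
    simp only [mul_zero, Real.exp_zero]
    rw [neg_div_neg_eq, one_div]

theorem integrableOn_cexp_mul_heat {w : ℂ} (hw2 : 0 < (w ^ 2).re) (a : ℝ) :
    IntegrableOn (fun t : ℝ => Complex.exp (-w ^ 2 * t) *
      ((Real.exp (-(a ^ 2 / (4 * t))) / √(4 * π * t) : ℝ) : ℂ)) (Set.Ioi 0) := by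
  refine (integrable_laplace_heat_fourier hw2 a).integral_prod_left.congr ?_
  filter_upwards [ae_restrict_mem measurableSet_Ioi] with t ht
  simp only [Function.uncurry_apply_pair]
  rw [integral_const_mul, integral_cexp_mul_cexp_neg_heat ht]

/-- The Laplace transform at `w²` of the one-dimensional heat kernel. -/
theorem integral_cexp_mul_heat {w : ℂ} (hw : 0 < w.re) (hw2 : 0 < (w ^ 2).re) {a : ℝ}
    (ha : 0 ≤ a) :
    ∫ t in Set.Ioi (0 : ℝ), Complex.exp (-w ^ 2 * t) *
      ((Real.exp (-(a ^ 2 / (4 * t))) / √(4 * π * t) : ℝ) : ℂ) =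
      Complex.exp (-w * a) / (2 * w) := by
  rw [← integral_cexp_mul_inv_sq_add_four_pi_sq_mul_sq hw hw2 ha]
  have hswap := integral_integral_swap (integrable_laplace_heat_fourier hw2 a)
  refine Eq.trans ?_ (hswap.trans ?_)
  · refine setIntegral_congr_fun measurableSet_Ioi fun t ht => ?_
    rw [integral_const_mul, integral_cexp_mul_cexp_neg_heat ht]
  · refine integral_congr_ae (.of_forall fun ξ => ?_)
    have hneg : (-(w ^ 2 + ((4 * π ^ 2 * ξ ^ 2 : ℝ) : ℂ))).re < 0 := by
      have : 0 ≤ 4 * π ^ 2 * ξ ^ 2 := by positivity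
      rw [Complex.neg_re, Complex.add_re, Complex.ofReal_re]
      linarith
    have h := integral_exp_mul_complex_Ioi hneg 0
    simp only [Complex.ofReal_zero, mul_zero, Complex.exp_zero, neg_div_neg_eq] at h
    simp only
    rw [← one_div, ← h, ← integral_const_mul]
    refine integral_congr_ae (.of_forall fun t => ?_)
    simp only
    rw [mul_left_comm, ← Complex.exp_add]
    congr 2
    ring

theorem integral_exp_mul_heat {c : ℝ} (hc : 0 < c) {a : ℝ} (ha : 0 ≤ a) :
    ∫ t in Set.Ioi (0 : ℝ), Real.exp (-c * t) *
      (Real.exp (-(a ^ 2 / (4 * t))) / √(4 * π * t)) =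
      Real.exp (-√c * a) / (2 * √c) := by
  have hsq : ((√c : ℝ) : ℂ) ^ 2 = (c : ℂ) := by
    rw [← Complex.ofReal_pow, Real.sq_sqrt hc.le]
  have h := integral_cexp_mul_heat (w := ((√c : ℝ) : ℂ)) (by simpa using hc)
    (by simpa [hsq] using hc) ha
  rw [hsq] at h
  apply Complex.ofReal_injective
  rw [← integral_complex_ofReal]
  push_cast at h ⊢
  exact h

theorem summable_exp_neg_mul_div_sinh_sq_add_sin_sq {l r : ℝ} (hl : 0 < l) (hr : 0 < r) (θ : ℝ) :
    Summable fun n : ℕ => Real.exp (-r * (l * ((n : ℝ) + 1))) /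
      (Real.sinh (l * ((n : ℝ) + 1) / 2) ^ 2 + Real.sin (θ * ((n : ℝ) + 1) / 2) ^ 2) := by
  have hs : 0 < Real.sinh (l / 2) := Real.sinh_pos_iff.2 (by positivity)
  have hgeom : Summable fun n : ℕ => Real.exp (n * (-(r * l))) / Real.sinh (l / 2) ^ 2 :=
    (Real.summable_exp_nat_mul_iff.2 (by nlinarith [mul_pos hr hl])).div_const _
  refine Summable.of_nonneg_of_le (fun n => by positivity) (fun n => ?_) hgeom
  have hle : Real.sinh (l / 2) ≤ Real.sinh (l * ((n : ℝ) + 1) / 2) :=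
    Real.sinh_le_sinh.2 (by nlinarith [mul_nonneg hl.le (Nat.cast_nonneg (α := ℝ) n)])
  refine div_le_div₀ (Real.exp_nonneg _) (Real.exp_le_exp.2 ?_) (by positivity) ?_
  · nlinarith [mul_pos hr hl]
  · exact (pow_le_pow_left₀ hs.le hle 2).trans (le_add_of_nonneg_right (sq_nonneg _))

/-- `∫₀^∞ e^{−s(s−2)t} Θ(t) dt = (l/(8(s−1))) Σ_{n≥1} e^{−nl(s−1)} / (sinh²(ln/2)+sin²(θn/2))`. -/
theorem btz_theta_laplace_eq_series (l θ : ℝ) (hl : 0 < l)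
    (s : ℂ) (hs : 1 < s.re) (hs2 : 0 < ((s - 1)^2).re) :
    ∫ t in Set.Ioi (0 : ℝ), Complex.exp (-s * (s - 2) * t) * (ThetaBTZ l θ t : ℂ)
      = (l : ℂ) / (8 * (s - 1)) *
        ∑' n : ℕ, Complex.exp (-((n : ℂ) + 1) * l * (s - 1)) /
          ((Real.sinh (l * ((n : ℝ) + 1) / 2)^2 + Real.sin (θ * ((n : ℝ) + 1) / 2)^2 : ℝ) : ℂ) := by
  set w : ℂ := s - 1 with hwdef
  have hw : 0 < w.re := by simpa [hwdef] using hs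
  set D : ℕ → ℝ := fun n =>
    Real.sinh (l * ((n : ℝ) + 1) / 2) ^ 2 + Real.sin (θ * ((n : ℝ) + 1) / 2) ^ 2 with hD
  set K : ℕ → ℝ → ℝ := fun n t =>
    Real.exp (-((l * ((n : ℝ) + 1)) ^ 2 / (4 * t))) / √(4 * π * t) with hK
  set F : ℕ → ℝ → ℂ := fun n t =>
    ((l / 4 / D n : ℝ) : ℂ) * (Complex.exp (-w ^ 2 * t) * (K n t : ℂ)) with hF
  have hD0 (n : ℕ) : 0 ≤ D n := by positivity
  have ha (n : ℕ) : 0 ≤ l * ((n : ℝ) + 1) := by positivity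
  have hint (n : ℕ) : Integrable (F n) (volume.restrict (Set.Ioi 0)) :=
    (integrableOn_cexp_mul_heat hs2 _).const_mul _
  have hnorm (n : ℕ) : ∫ t in Set.Ioi (0 : ℝ), ‖F n t‖ =
      l / (8 * √(w ^ 2).re) * (Real.exp (-√(w ^ 2).re * (l * ((n : ℝ) + 1))) / D n) := by
    have h1 (t : ℝ) : ‖F n t‖ = l / 4 / D n * (Real.exp (-(w ^ 2).re * t) * K n t) := by
      have hK0 : 0 ≤ K n t := by positivity
      have hc : 0 ≤ l / 4 / D n := div_nonneg (by positivity) (hD0 n)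
      simp only [hF]
      rw [norm_mul, norm_mul, Complex.norm_of_nonneg hc, Complex.norm_of_nonneg hK0,
        Complex.norm_exp, Complex.re_mul_ofReal, Complex.neg_re]
    simp_rw [h1]
    rw [integral_const_mul, integral_exp_mul_heat hs2 (ha n)]
    ring
  have hsum : Summable fun n => ∫ t in Set.Ioi (0 : ℝ), ‖F n t‖ := by
    simp_rw [hnorm]
    exact (summable_exp_neg_mul_div_sinh_sq_add_sin_sq hl (Real.sqrt_pos.2 hs2) θ).mul_left _
  have hpoint (t : ℝ) (ht : t ∈ Set.Ioi (0 : ℝ)) :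
      Complex.exp (-s * (s - 2) * t) * (ThetaBTZ l θ t : ℂ) = ∑' n, F n t := by
    rw [ThetaBTZ, ← tsum_mul_left, Complex.ofReal_tsum, ← tsum_mul_left]
    refine tsum_congr fun n => ?_
    have hexp : Complex.exp (-s * (s - 2) * t) =
        Complex.exp (-w ^ 2 * t) * ((Real.exp t : ℝ) : ℂ) := by
      rw [Complex.ofReal_exp, ← Complex.exp_add]
      congr 1
      rw [hwdef]
      ring
    have hreal : Real.exp t * (l / (4 * √(4 * π * t)) *
        (Real.exp (-(t + ((n : ℝ) + 1) ^ 2 * l ^ 2 / (4 * t))) / D n)) =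
        l / 4 / D n * K n t := by
      simp only [hK]
      rw [neg_add, Real.exp_add, Real.exp_neg t,
        show (l * ((n : ℝ) + 1)) ^ 2 = ((n : ℝ) + 1) ^ 2 * l ^ 2 by ring]
      have := Real.exp_ne_zero t
      field_simp
    rw [hexp, mul_assoc, ← Complex.ofReal_mul, hreal]
    simp only [hF]
    push_cast
    ring
  rw [setIntegral_congr_fun measurableSet_Ioi hpoint,
    ← integral_tsum_of_summable_integral_norm hint hsum, ← tsum_mul_left]
  refine tsum_congr fun n => ?_
  change _ = (l : ℂ) / (8 * w) * (Complex.exp (-((n : ℂ) + 1) * l * w) / (D n : ℂ))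
  simp only [hF, hK]
  rw [integral_const_mul, integral_cexp_mul_heat hw hs2 (ha n),
    show -((n : ℂ) + 1) * l * w = -w * ((l * ((n : ℝ) + 1) : ℝ) : ℂ) by push_cast; ring]
  push_cast
  clear_value w
  ring
end

section
/- Let l > 0 and θ ∈ ℝ. For every s ∈ ℂ with Re s > 0, the logarithmic derivative of the Patterson–Selberg zeta function satisfies Z′(s)/Z(s) = (l/4) · Σ_{n=1}^∞ e^{−nl(s−1)} / (sinh²(ln/2) + sin²(θn/2)), where the series on the right converges absolutely for Re s > 0. -/
lemma norm_exp_neg_mul_lt_one {l : ℝ} (hl : 0 < l) {s : ℂ} (hs : 0 < s.re) :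
    ‖Complex.exp (-s * l)‖ < 1 := by
  rw [Complex.norm_exp]
  simpa using mul_pos hs hl

lemma logDeriv_one_sub_mul_exp {c s : ℂ} {l : ℝ} (h : ‖c * Complex.exp (-s * l)‖ < 1) :
    logDeriv (fun z : ℂ ↦ 1 - c * Complex.exp (-z * l)) s
      = l * ∑' n : ℕ, (c * Complex.exp (-s * l)) ^ (n + 1) := by
  have hd : HasDerivAt (fun z : ℂ ↦ 1 - c * Complex.exp (-z * l))
      (-(c * (Complex.exp (-s * l) * (-1 * l)))) s :=
    ((((hasDerivAt_id s).neg.mul_const (l : ℂ)).cexp).const_mul c).const_sub 1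
  rw [logDeriv_apply, hd.deriv]
  simp only [pow_succ]
  rw [tsum_mul_right, tsum_geometric_of_norm_lt_one h]
  ring

lemma summable_prod_mul_pow_succ {ι : Type*} {c : ι → ℂ} (hc : Summable fun i ↦ ‖c i‖)
    (hc1 : ∀ i, ‖c i‖ ≤ 1) {w : ℂ} (hw : ‖w‖ < 1) :
    Summable fun p : ι × ℕ ↦ (c p.1 * w) ^ (p.2 + 1) := by
  have hgeom : Summable fun n : ℕ ↦ ‖w‖ ^ (n + 1) :=
    (summable_nat_add_iff 1).mpr (summable_geometric_of_lt_one (norm_nonneg _) hw)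
  have hprod : Summable fun p : ι × ℕ ↦ ‖c p.1‖ * ‖w‖ ^ (p.2 + 1) :=
    hc.mul_of_nonneg hgeom (fun _ ↦ norm_nonneg _) fun _ ↦ by positivity
  refine hprod.of_norm_bounded ?_
  rintro ⟨i, n⟩
  rw [norm_pow, norm_mul, mul_pow]
  exact mul_le_mul_of_nonneg_right (pow_le_of_le_one (norm_nonneg _) (hc1 i) n.succ_ne_zero)
    (by positivity)

/-- Logarithmic derivative of a product `∏ᵢ (1 - cᵢ e^{-ls})` with absolutely summable coefficients
in the closed unit disc, expanded into power sums of the coefficients. -/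
lemma hasSum_logDeriv_tprod_one_sub_mul_exp {ι : Type*} {c : ι → ℂ} (hc : Summable fun i ↦ ‖c i‖)
    (hc1 : ∀ i, ‖c i‖ ≤ 1) {l : ℝ} (hl : 0 < l) {s : ℂ} (hs : 0 < s.re) :
    HasSum (fun n : ℕ ↦ (l : ℂ) * ∑' i, (c i * Complex.exp (-s * l)) ^ (n + 1))
      (logDeriv (fun z : ℂ ↦ ∏' i, (1 - c i * Complex.exp (-z * l))) s) := by
  have hlt : ∀ i, ‖c i * Complex.exp (-s * l)‖ < 1 := by
    intro i
    rw [norm_mul]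
    exact (mul_le_of_le_one_left (norm_nonneg _) (hc1 i)).trans_lt (norm_exp_neg_mul_lt_one hl hs)
  have hne : ∀ i, 1 - c i * Complex.exp (-s * l) ≠ 0 := by
    intro i h
    have h1 := hlt i
    rw [← sub_eq_zero.mp h, norm_one] at h1
    exact lt_irrefl _ h1
  have hopen : IsOpen {z : ℂ | 0 < z.re} := isOpen_lt continuous_const Complex.continuous_re
  have hmul : MultipliableLocallyUniformlyOn
      (fun i (z : ℂ) ↦ 1 - c i * Complex.exp (-z * l)) {z : ℂ | 0 < z.re} := by
    have := Summable.multipliableLocallyUniformlyOn_one_add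
      (f := fun i (z : ℂ) ↦ -(c i * Complex.exp (-z * l))) hopen hc
      (.of_forall fun i z hz ↦ by
        rw [norm_neg, norm_mul]
        exact mul_le_of_le_one_right (norm_nonneg _) (norm_exp_neg_mul_lt_one hl hz).le)
      (fun i ↦ by fun_prop)
    simpa only [← sub_eq_add_neg] using this
  have hnez : ∏' i, (1 - c i * Complex.exp (-s * l)) ≠ 0 := by
    simp only [sub_eq_add_neg] at hne ⊢
    refine tprod_one_add_ne_zero_of_summable hne ?_
    simp only [norm_neg, norm_mul]
    exact hc.mul_right _
  have hdouble := summable_prod_mul_pow_succ hc hc1 (norm_exp_neg_mul_lt_one hl hs)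
  have hlog : ∀ i, logDeriv (fun z : ℂ ↦ 1 - c i * Complex.exp (-z * l)) s
      = l * ∑' n : ℕ, (c i * Complex.exp (-s * l)) ^ (n + 1) :=
    fun i ↦ logDeriv_one_sub_mul_exp (hlt i)
  have hswap : Summable fun i ↦ logDeriv (fun z : ℂ ↦ 1 - c i * Complex.exp (-z * l)) s := by
    simp only [hlog]
    exact hdouble.prod.mul_left (l : ℂ)
  rw [logDeriv_tprod_eq_tsum hopen (show s ∈ {z : ℂ | 0 < z.re} from hs) hne
    (fun i ↦ by fun_prop) hswap hmul hnez]
  simp only [hlog]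
  rw [tsum_mul_left, ← Summable.tsum_comm (f := fun i n ↦ (c i * Complex.exp (-s * l)) ^ (n + 1))
    hdouble]
  exact hdouble.prod_symm.prod.hasSum.mul_left (l : ℂ)

lemma tsum_prod_geometric {a b : ℂ} (ha : ‖a‖ < 1) (hb : ‖b‖ < 1) :
    ∑' k : ℕ × ℕ, a ^ k.1 * b ^ k.2 = ((1 - a) * (1 - b))⁻¹ := by
  rw [← tsum_mul_tsum_of_summable_norm (summable_norm_geometric_of_norm_lt_one ha)
    (summable_norm_geometric_of_norm_lt_one hb), tsum_geometric_of_norm_lt_one ha,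
    tsum_geometric_of_norm_lt_one hb, mul_inv]

lemma one_sub_exp_mul_one_sub_exp (x y : ℂ) :
    (1 - Complex.exp (Complex.I * y - x)) * (1 - Complex.exp (-(Complex.I * y) - x))
      = 4 * Complex.exp (-x) * (Complex.sinh (x / 2) ^ 2 + Complex.sin (y / 2) ^ 2) := by
  have hx : Complex.exp (-x) = (Complex.exp (x / 2) ^ 2)⁻¹ := by
    rw [← Complex.exp_nat_mul, ← Complex.exp_neg]
    push_cast
    ring_nf
  have hy : Complex.exp (Complex.I * y) = Complex.exp (y / 2 * Complex.I) ^ 2 := by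
    rw [← Complex.exp_nat_mul]
    push_cast
    ring_nf
  rw [Complex.sinh, Complex.sin, sub_eq_add_neg (Complex.I * y), sub_eq_add_neg (-(Complex.I * y)),
    Complex.exp_add, Complex.exp_add, Complex.exp_neg (Complex.I * y), hx, hy, neg_mul,
    Complex.exp_neg, Complex.exp_neg]
  have h1 := Complex.exp_ne_zero (x / 2)
  have h2 := Complex.exp_ne_zero (y / 2 * Complex.I)
  generalize Complex.exp (x / 2) = u at *
  generalize Complex.exp (y / 2 * Complex.I) = v at *
  field_simp
  rw [Complex.I_sq]
  ring


open Real

/-- For `Re s > 0`, the logarithmic derivative of the Patterson–Selberg zeta function is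
`Z′(s)/Z(s) = (l/4) Σ_{n≥1} e^{−nl(s−1)} / (sinh²(ln/2) + sin²(θn/2))`, and the series on
the right converges absolutely. -/
theorem btz_zeta_log_deriv (l θ : ℝ) (hl : 0 < l) (s : ℂ) (hs : 0 < s.re) :
    deriv (ZPS l θ) s / ZPS l θ s
        = (l : ℂ) / 4 *
          ∑' n : ℕ, Complex.exp (-((n : ℂ) + 1) * l * (s - 1)) /
            ((Real.sinh (l * ((n : ℝ) + 1) / 2)^2 + Real.sin (θ * ((n : ℝ) + 1) / 2)^2 : ℝ) : ℂ)
      ∧ Summable (fun n : ℕ =>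
          ‖Complex.exp (-((n : ℂ) + 1) * l * (s - 1)) /
            ((Real.sinh (l * ((n : ℝ) + 1) / 2)^2 + Real.sin (θ * ((n : ℝ) + 1) / 2)^2 : ℝ) : ℂ)‖) := by
  set a : ℂ := Complex.exp (Complex.I * θ - l) with ha
  set b : ℂ := Complex.exp (-(Complex.I * θ) - l) with hb
  have ha1 : ‖a‖ < 1 := by
    rw [ha, Complex.norm_exp]
    simpa using hl
  have hb1 : ‖b‖ < 1 := by
    rw [hb, Complex.norm_exp]
    simpa using hl
  have hZ : ZPS l θ = fun z : ℂ ↦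
      ∏' k : ℕ × ℕ, (1 - a ^ k.1 * b ^ k.2 * Complex.exp (-z * l)) := by
    funext z
    refine tprod_congr fun k ↦ ?_
    rw [ha, hb, ← Complex.exp_nat_mul, ← Complex.exp_nat_mul]
    simp only [← Complex.exp_add]
    ring_nf
  have hc : Summable fun k : ℕ × ℕ ↦ ‖a ^ k.1 * b ^ k.2‖ :=
    (summable_norm_geometric_of_norm_lt_one ha1).mul_norm
      (summable_norm_geometric_of_norm_lt_one hb1)
  have hc1 : ∀ k : ℕ × ℕ, ‖a ^ k.1 * b ^ k.2‖ ≤ 1 := by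
    intro k
    rw [norm_mul, norm_pow, norm_pow]
    exact mul_le_one₀ (pow_le_one₀ (norm_nonneg _) ha1.le) (by positivity)
      (pow_le_one₀ (norm_nonneg _) hb1.le)
  have hterm : ∀ n : ℕ,
      (l : ℂ) * ∑' k : ℕ × ℕ, (a ^ k.1 * b ^ k.2 * Complex.exp (-s * l)) ^ (n + 1)
        = (l : ℂ) / 4 * (Complex.exp (-((n : ℂ) + 1) * l * (s - 1)) /
          ((Real.sinh (l * ((n : ℝ) + 1) / 2)^2 + Real.sin (θ * ((n : ℝ) + 1) / 2)^2 : ℝ) : ℂ)) := by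
    intro n
    have hpow : ∀ k : ℕ × ℕ, (a ^ k.1 * b ^ k.2 * Complex.exp (-s * l)) ^ (n + 1)
        = (a ^ (n + 1)) ^ k.1 * (b ^ (n + 1)) ^ k.2 * Complex.exp (-s * l) ^ (n + 1) := by
      intro k
      rw [mul_pow, mul_pow, pow_right_comm a, pow_right_comm b]
    have hpa : ‖a ^ (n + 1)‖ < 1 := by
      rw [norm_pow]
      exact pow_lt_one₀ (norm_nonneg _) ha1 n.succ_ne_zero
    have hpb : ‖b ^ (n + 1)‖ < 1 := by
      rw [norm_pow]
      exact pow_lt_one₀ (norm_nonneg _) hb1 n.succ_ne_zero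
    have hea : a ^ (n + 1) = Complex.exp (Complex.I * (θ * (n + 1)) - l * (n + 1)) := by
      rw [ha, ← Complex.exp_nat_mul]
      push_cast
      ring_nf
    have heb : b ^ (n + 1) = Complex.exp (-(Complex.I * (θ * (n + 1))) - l * (n + 1)) := by
      rw [hb, ← Complex.exp_nat_mul]
      push_cast
      ring_nf
    have hexp : Complex.exp (-((n : ℂ) + 1) * l * (s - 1))
        = Complex.exp (-s * l) ^ (n + 1) / Complex.exp (-(l * (n + 1))) := by
      rw [← Complex.exp_nat_mul, ← Complex.exp_sub]
      push_cast
      ring_nf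
    simp only [hpow]
    rw [tsum_mul_right, tsum_prod_geometric hpa hpb, hea, heb, one_sub_exp_mul_one_sub_exp, hexp]
    push_cast
    simp only [div_eq_mul_inv, mul_inv]
    ring
  have hsum := hasSum_logDeriv_tprod_one_sub_mul_exp hc hc1 hl hs
  simp only [hterm, ← hZ] at hsum
  have hl4 : (l : ℂ) / 4 ≠ 0 := by
    simpa using hl.ne'
  refine ⟨?_, ((summable_mul_left_iff hl4).mp hsum.summable).norm⟩
  rw [← logDeriv_apply, ← hsum.tsum_eq, tsum_mul_left]
end

section
/- Let a > 0 and b ≥ 0, and set l := 2a, θ := 2b. Then the set of BTZ scattering resonances coincides with the set of Patterson–Selberg zeta zeros; that is, as subsets of ℂ: { −2j − |m| + ε·i·|(−mb + πn)/a| : j ∈ ℕ, m ∈ ℤ, n ∈ ℤ, ε ∈ {+1, −1} } = { −(k₁ + k₂) + i(k₁ − k₂)·(θ/l) + 2πin/l : k₁, k₂ ∈ ℕ, n ∈ ℤ }. -/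
open Real

/-- The resonances attached to `m`, `n` and both signs are, up to flipping the signs of `m` and `n`,
the points with signed imaginary part. -/
theorem resonance_iff_signed (a b : ℝ) (z : ℂ) :
    (∃ (j : ℕ) (m n : ℤ) (ε : ℤ), (ε = 1 ∨ ε = -1) ∧
        z = -2 * (j : ℂ) - (|(m : ℝ)| : ℝ)
              + (ε : ℂ) * Complex.I * (|(-(m : ℝ) * b + Real.pi * (n : ℝ)) / a| : ℝ)) ↔
      ∃ (j : ℕ) (d n : ℤ),
        z = -2 * (j : ℂ) - (|(d : ℝ)| : ℝ)
              + Complex.I * (((d : ℝ) * b + Real.pi * (n : ℝ)) / a : ℝ) := by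
  constructor
  · rintro ⟨j, m, n, ε, hε, rfl⟩
    obtain ⟨σ, hσ, h⟩ : ∃ σ : ℤ, (σ = 1 ∨ σ = -1) ∧
        (ε : ℝ) * |(-(m : ℝ) * b + Real.pi * (n : ℝ)) / a|
          = σ * ((-(m : ℝ) * b + Real.pi * (n : ℝ)) / a) := by
      rcases abs_choice ((-(m : ℝ) * b + Real.pi * (n : ℝ)) / a) with h | h
      · exact ⟨ε, hε, by rw [h]⟩
      · exact ⟨-ε, by omega, by rw [h]; push_cast; ring⟩
    refine ⟨j, -(σ * m), σ * n, ?_⟩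
    have habs : |((-(σ * m) : ℤ) : ℝ)| = |(m : ℝ)| := by
      rcases hσ with rfl | rfl <;> simp
    have him : (((-(σ * m) : ℤ) : ℝ) * b + Real.pi * ((σ * n : ℤ) : ℝ)) / a
        = ε * |(-(m : ℝ) * b + Real.pi * (n : ℝ)) / a| := by
      rw [h]; push_cast; ring
    rw [habs, him, Complex.ofReal_mul, Complex.ofReal_intCast]
    ring
  · rintro ⟨j, d, n, rfl⟩
    have hm : -((-d : ℤ) : ℝ) = d := by push_cast; ring
    rcases abs_choice (((d : ℝ) * b + Real.pi * (n : ℝ)) / a) with h | h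
    · refine ⟨j, -d, n, 1, Or.inl rfl, ?_⟩
      rw [hm, h, Int.cast_neg, abs_neg]
      push_cast
      ring
    · refine ⟨j, -d, n, -1, Or.inr rfl, ?_⟩
      rw [hm, h, Int.cast_neg, abs_neg]
      push_cast
      ring

/-- Pairs `(k₁, k₂)` correspond to pairs `(j, d)` through `j = min k₁ k₂` and `d = k₁ - k₂`. -/
theorem zeta_zero_iff_signed (a b : ℝ) (z : ℂ) :
    (∃ (k₁ k₂ : ℕ) (n : ℤ),
        z = -((k₁ : ℂ) + (k₂ : ℂ))
              + Complex.I * ((k₁ : ℂ) - (k₂ : ℂ)) * (((2 * b) / (2 * a) : ℝ) : ℂ)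
              + 2 * Real.pi * Complex.I * (n : ℂ) / ((2 * a : ℝ) : ℂ)) ↔
      ∃ (j : ℕ) (d n : ℤ),
        z = -2 * (j : ℂ) - (|(d : ℝ)| : ℝ)
              + Complex.I * (((d : ℝ) * b + Real.pi * (n : ℝ)) / a : ℝ) := by
  have key (k₁ k₂ j : ℕ) (d n : ℤ) (hd : (k₁ : ℤ) - k₂ = d) (hj : (k₁ : ℤ) + k₂ = 2 * j + |d|) :
      -((k₁ : ℂ) + (k₂ : ℂ))
              + Complex.I * ((k₁ : ℂ) - (k₂ : ℂ)) * (((2 * b) / (2 * a) : ℝ) : ℂ)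
              + 2 * Real.pi * Complex.I * (n : ℂ) / ((2 * a : ℝ) : ℂ)
        = -2 * (j : ℂ) - (|(d : ℝ)| : ℝ)
              + Complex.I * (((d : ℝ) * b + Real.pi * (n : ℝ)) / a : ℝ) := by
    have hd' : (k₁ : ℂ) - k₂ = d := by exact_mod_cast congrArg (Int.cast : ℤ → ℂ) hd
    have hj' : (k₁ : ℂ) + k₂ = 2 * j + (|(d : ℝ)| : ℝ) := by
      rw [← Int.cast_abs]
      exact_mod_cast congrArg (Int.cast : ℤ → ℂ) hj
    rw [hd', hj', mul_div_mul_left b a two_ne_zero]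
    push_cast
    rw [mul_assoc (2 * (Real.pi : ℂ)), mul_assoc 2, mul_div_mul_left _ _ two_ne_zero]
    ring
  constructor
  · rintro ⟨k₁, k₂, n, rfl⟩
    exact ⟨min k₁ k₂, k₁ - k₂, n, key _ _ _ _ _ rfl (by rw [abs_eq_max_neg]; omega)⟩
  · rintro ⟨j, d, n, rfl⟩
    exact ⟨j + d.toNat, j + (-d).toNat, n,
      (key _ _ _ _ _ (by omega) (by rw [abs_eq_max_neg]; omega)).symm⟩

/-- For `a > 0`, `b ≥ 0`, with `l = 2a` and `θ = 2b`, the set of BTZ scattering resonances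
`s±_{mnj} = −2j − |m| ± i|(−mb + πn)/a|` coincides with the set of Patterson–Selberg zeta
zeros `ζ_{n,k₁,k₂} = −(k₁+k₂) + i(k₁−k₂)θ/l + 2πin/l`. -/
theorem btz_resonances_eq_zeta_zeros (a b : ℝ) (ha : 0 < a) (hb : 0 ≤ b) :
    {z : ℂ | ∃ (j : ℕ) (m n : ℤ) (ε : ℤ), (ε = 1 ∨ ε = -1) ∧
        z = -2 * (j : ℂ) - (|(m : ℝ)| : ℝ)
              + (ε : ℂ) * Complex.I * (|(-(m : ℝ) * b + Real.pi * (n : ℝ)) / a| : ℝ)}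
      = {z : ℂ | ∃ (k₁ k₂ : ℕ) (n : ℤ),
        z = -((k₁ : ℂ) + (k₂ : ℂ))
              + Complex.I * ((k₁ : ℂ) - (k₂ : ℂ)) * (((2 * b) / (2 * a) : ℝ) : ℂ)
              + 2 * Real.pi * Complex.I * (n : ℂ) / ((2 * a : ℝ) : ℂ)} := by
  ext z
  exact (resonance_iff_signed a b z).trans (zeta_zero_iff_signed a b z).symm
end

section
/- For all real numbers a ≥ 0 and p > 0, ∫₀^∞ t^{−1/2} e^{−a/(4t)} e^{−pt} dt = √π · p^{−1/2} · e^{−√(ap)}. -/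
open Real MeasureTheory

/-- Multiplying the Gaussian by `1 + g` with `g` odd, continuous and bounded does not change its
integral. -/
theorem integral_gaussian_mul_one_add_odd {g : ℝ → ℝ} (hg : Continuous g)
    (hodd : ∀ u, g (-u) = -g u) (hbound : ∀ u, |g u| ≤ 1) :
    ∫ u : ℝ, Real.exp (-u ^ 2) * (1 + g u) = Real.sqrt Real.pi := by
  have hexp : Integrable fun u : ℝ => Real.exp (-u ^ 2) := by
    simpa using integrable_exp_neg_mul_sq (b := 1) one_pos
  have hprod : Integrable fun u : ℝ => Real.exp (-u ^ 2) * g u :=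
    hexp.mul_bdd hg.aestronglyMeasurable (Filter.Eventually.of_forall hbound)
  have hzero : ∫ u : ℝ, Real.exp (-u ^ 2) * g u = 0 := by
    have h := integral_neg_eq_self (fun u : ℝ => Real.exp (-u ^ 2) * g u) volume
    simp only [hodd, neg_sq, mul_neg, integral_neg] at h
    linarith
  simp only [mul_add, mul_one]
  rw [integral_add hexp hprod, hzero, add_zero]
  simpa using integral_gaussian 1

/-- The positive root `s` of `α * s ^ 2 - u * s - β = 0`. -/
noncomputable def posRoot (α β u : ℝ) : ℝ := (u + Real.sqrt (u ^ 2 + 4 * α * β)) / (2 * α)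

section posRoot

variable {α β : ℝ}

theorem sq_add_four_mul_pos (hα : 0 < α) (hβ : 0 < β) (u : ℝ) : 0 < u ^ 2 + 4 * α * β := by
  positivity

theorem abs_lt_sqrt_sq_add (hα : 0 < α) (hβ : 0 < β) (u : ℝ) :
    |u| < Real.sqrt (u ^ 2 + 4 * α * β) := by
  rw [← Real.sqrt_sq_eq_abs]
  exact Real.sqrt_lt_sqrt (sq_nonneg u) (by linarith [mul_pos (mul_pos four_pos hα) hβ])

theorem posRoot_pos (hα : 0 < α) (hβ : 0 < β) (u : ℝ) : 0 < posRoot α β u :=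
  div_pos (by linarith [neg_abs_le u, abs_lt_sqrt_sq_add hα hβ u]) (by positivity)

theorem posRoot_spec (hα : 0 < α) (hβ : 0 < β) (u : ℝ) :
    α * posRoot α β u - β / posRoot α β u = u := by
  have hs := posRoot_pos hα hβ u
  have hr := Real.sq_sqrt (sq_add_four_mul_pos hα hβ u).le
  have hroot : 2 * α * posRoot α β u = u + Real.sqrt (u ^ 2 + 4 * α * β) := by
    unfold posRoot; field_simp
  have hquad : α * posRoot α β u ^ 2 - β = u * posRoot α β u := by
    refine mul_left_cancel₀ (a := 4 * α) (by positivity) ?_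
    rw [show Real.sqrt (u ^ 2 + 4 * α * β) = 2 * α * posRoot α β u - u by linarith] at hr
    linarith
  field_simp
  linarith

theorem posRoot_sub_div (hα : 0 < α) (hβ : 0 < β) {s : ℝ} (hs : 0 < s) :
    posRoot α β (α * s - β / s) = s := by
  have hsq : (α * s - β / s) ^ 2 + 4 * α * β = (α * s + β / s) ^ 2 := by
    field_simp; ring
  rw [posRoot, hsq, Real.sqrt_sq (by positivity)]
  field_simp
  ring

theorem hasDerivAt_posRoot (hα : 0 < α) (hβ : 0 < β) (u : ℝ) :
    HasDerivAt (posRoot α β) (posRoot α β u / Real.sqrt (u ^ 2 + 4 * α * β)) u := by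
  have hpos := sq_add_four_mul_pos hα hβ u
  have hr := Real.sqrt_pos.2 hpos
  have h := ((hasDerivAt_id u).add
    ((((hasDerivAt_id u).pow 2).add_const (4 * α * β)).sqrt hpos.ne')).div_const (2 * α)
  refine h.congr_deriv ?_
  simp only [posRoot, Pi.pow_apply, id, Nat.cast_ofNat, pow_one, mul_one, Nat.add_one_sub_one]
  field_simp
  ring

theorem posRoot_sq_injective (hα : 0 < α) (hβ : 0 < β) :
    Function.Injective fun u => posRoot α β u ^ 2 := by
  intro u v h
  have h' : posRoot α β u = posRoot α β v :=
    (sq_eq_sq₀ (posRoot_pos hα hβ u).le (posRoot_pos hα hβ v).le).1 h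
  rw [← posRoot_spec hα hβ u, ← posRoot_spec hα hβ v, h']

theorem image_posRoot_sq (hα : 0 < α) (hβ : 0 < β) :
    (fun u => posRoot α β u ^ 2) '' Set.univ = Set.Ioi 0 := by
  ext t
  simp only [Set.image_univ, Set.mem_range, Set.mem_Ioi]
  refine ⟨?_, fun ht => ⟨α * Real.sqrt t - β / Real.sqrt t, ?_⟩⟩
  · rintro ⟨u, rfl⟩
    exact pow_pos (posRoot_pos hα hβ u) 2
  · rw [posRoot_sub_div hα hβ (Real.sqrt_pos.2 ht), Real.sq_sqrt ht.le]

end posRoot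

theorem integral_rpow_mul_exp_neg_div_mul_exp_neg {α β : ℝ} (hα : 0 < α) (hβ : 0 < β) :
    ∫ t in Set.Ioi (0 : ℝ),
        t ^ (-(1 : ℝ) / 2) * Real.exp (-β ^ 2 / t) * Real.exp (-α ^ 2 * t)
      = Real.sqrt Real.pi * α⁻¹ * Real.exp (-(2 * α * β)) := by
  have hderiv (u : ℝ) (_ : u ∈ Set.univ) :
      HasDerivWithinAt (fun u => posRoot α β u ^ 2) _ Set.univ u :=
    ((hasDerivAt_posRoot hα hβ u).pow 2).hasDerivWithinAt (s := Set.univ)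
  rw [← image_posRoot_sq hα hβ]
  rw [integral_image_eq_integral_abs_deriv_smul MeasurableSet.univ hderiv
    (posRoot_sq_injective hα hβ).injOn]
  have hbound (u : ℝ) : |u / Real.sqrt (u ^ 2 + 4 * α * β)| ≤ 1 := by
    rw [abs_div, abs_of_nonneg (Real.sqrt_nonneg _)]
    exact div_le_one_of_le₀ (abs_lt_sqrt_sq_add hα hβ u).le (Real.sqrt_nonneg _)
  have hcont : Continuous fun u : ℝ => u / Real.sqrt (u ^ 2 + 4 * α * β) :=
    continuous_id.div (by fun_prop)
      fun u => (Real.sqrt_pos.2 (sq_add_four_mul_pos hα hβ u)).ne'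
  have hgauss := integral_gaussian_mul_one_add_odd hcont
    (fun u => by simp only [neg_sq, neg_div]) hbound
  rw [← hgauss, mul_assoc (∫ _, _), ← integral_mul_const, setIntegral_univ]
  congr with u
  have hs := posRoot_pos hα hβ u
  have hr := Real.sqrt_pos.2 (sq_add_four_mul_pos hα hβ u)
  have hroot : 2 * α * posRoot α β u = u + Real.sqrt (u ^ 2 + 4 * α * β) := by
    unfold posRoot; field_simp
  have hrpow : (posRoot α β u ^ 2) ^ (-(1 : ℝ) / 2) = (posRoot α β u)⁻¹ := by
    rw [← Real.rpow_natCast, ← Real.rpow_mul hs.le, ← Real.rpow_neg_one]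
    norm_num
  have hexp : Real.exp (-β ^ 2 / posRoot α β u ^ 2) * Real.exp (-α ^ 2 * posRoot α β u ^ 2)
      = Real.exp (-u ^ 2) * Real.exp (-(2 * α * β)) := by
    rw [← Real.exp_add, ← Real.exp_add]
    congr 1
    have hspec := posRoot_spec hα hβ u
    generalize posRoot α β u = s at hs hspec
    rw [← hspec]
    field_simp
    ring
  have hfactor : 1 + u / Real.sqrt (u ^ 2 + 4 * α * β)
      = 2 * α * posRoot α β u / Real.sqrt (u ^ 2 + 4 * α * β) := by
    rw [hroot]; field_simp; ring
  simp only [smul_eq_mul]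
  rw [abs_of_pos (by positivity), mul_assoc (_ ^ (-(1 : ℝ) / 2)), hexp, hrpow, hfactor]
  field_simp
  norm_num
  ring

/-- The Laplace transform formula
`∫₀^∞ t^{−1/2} e^{−a/(4t)} e^{−pt} dt = √π p^{−1/2} e^{−√(ap)}` for `a ≥ 0`, `p > 0`. -/
theorem laplace_transform_formula (a p : ℝ) (ha : 0 ≤ a) (hp : 0 < p) :
    ∫ t in Set.Ioi (0 : ℝ), t ^ (-(1 : ℝ) / 2) * Real.exp (-a / (4 * t)) * Real.exp (-p * t)
      = Real.sqrt Real.pi * p ^ (-(1 : ℝ) / 2) * Real.exp (-Real.sqrt (a * p)) := by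
  rcases ha.eq_or_lt with rfl | ha
  · have h := Real.integral_rpow_mul_exp_neg_mul_Ioi (a := 1 / 2) (by norm_num) hp
    rw [Real.Gamma_one_half_eq, one_div p, Real.inv_rpow hp.le, ← Real.rpow_neg hp.le] at h
    norm_num at h ⊢
    rw [h, mul_comm]
  · have h := integral_rpow_mul_exp_neg_div_mul_exp_neg (Real.sqrt_pos.2 hp)
      (half_pos (Real.sqrt_pos.2 ha))
    have hpow : p ^ (-(1 : ℝ) / 2) = (Real.sqrt p)⁻¹ := by
      rw [neg_div, Real.rpow_neg hp.le, Real.sqrt_eq_rpow]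
    have hmul : Real.sqrt (a * p) = 2 * Real.sqrt p * (Real.sqrt a / 2) := by
      rw [Real.sqrt_mul ha.le]; ring
    rw [hpow, hmul, ← h]
    refine setIntegral_congr_fun measurableSet_Ioi fun t _ => ?_
    simp only [div_pow, Real.sq_sqrt hp.le, Real.sq_sqrt ha.le]
    congr 3
    ring
end
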